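/- arXiv:1607.05976 — 9 statements merged into one kernel-verified Lean document; each statement's English description precedes it below -/
import Mathlib

section
/- Let d ≥ 2 be an integer and let F_0, …, F_N ∈ k[T_0, …, T_N] be homogeneous polynomials of degree d, all of whose coefficients have absolute value at most 1, and whose only common zero in k^{N+1} is 0. Set F(z) = (F_0(z), …, F_N(z)) for z ∈ k^{N+1}. Then the sequence of functions G_n(z) = d^{-n}·log ‖F^{∘n}(z)‖ (where F^{∘n} is the n-th iterate of F) converges uniformly on k^{N+1} \ {0} to a function G_F which: (i) is continuous on k^{N+1} \ {0}; (ii) satisfies G_F(λ·z) = G_F(z) + log|λ| for every λ ∈ k with λ ≠ 0 and every z ≠ 0; and (iii) satisfies sup_{z ≠ 0} |G_F(z) − log ‖z‖| < ∞. -/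
open Filter

namespace MvPolynomial

theorem IsHomogeneous.eval_smul {σ R : Type*} [Fintype σ] [CommSemiring R]
    {p : MvPolynomial σ R} {d : ℕ} (hp : p.IsHomogeneous d) (c : R) (z : σ → R) :
    eval (c • z) p = c ^ d * eval z p := by
  rw [eval_eq', eval_eq', Finset.mul_sum]
  refine Finset.sum_congr rfl fun m hm => ?_
  have hdeg : ∑ i, m i = d := by
    rw [← hp (mem_support_iff.mp hm), Finsupp.weight_apply, Finsupp.sum_fintype _ _ (by simp)]
    simp
  simp only [Pi.smul_apply, smul_eq_mul, mul_pow, Finset.prod_mul_distrib,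
    Finset.prod_pow_eq_pow_sum, hdeg]
  ring

theorem exists_norm_eval_le {σ k : Type*} [Fintype σ] [NormedField k] (p : MvPolynomial σ k) :
    ∃ C : ℝ, 0 ≤ C ∧ ∀ w : σ → k, ‖w‖ ≤ 1 → ‖eval w p‖ ≤ C := by
  refine ⟨∑ m ∈ p.support, ‖p.coeff m‖, Finset.sum_nonneg fun _ _ => norm_nonneg _,
    fun w hw => ?_⟩
  rw [eval_eq']
  refine norm_sum_le_of_le _ fun m _ => ?_
  rw [norm_mul, norm_prod]
  refine mul_le_of_le_one_right (norm_nonneg _)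
    (Finset.prod_le_one (fun _ _ => norm_nonneg _) fun i _ => ?_)
  rw [norm_pow]
  exact pow_le_one₀ (norm_nonneg _) ((norm_le_pi_norm w i).trans hw)

/-- A quantitative form of the Nullstellensatz: if the origin is the only common zero of the
`P j`, then the `P j` are not simultaneously small at a point some coordinate of which is `1`
and whose coordinates are bounded by `1`. -/
theorem exists_one_le_mul_norm_eval {σ ι k : Type*} [Fintype σ] [Fintype ι] [NormedField k]
    [IsAlgClosed k] (P : ι → MvPolynomial σ k)
    (hzero : ∀ z : σ → k, (∀ j, eval z (P j) = 0) → z = 0) (i : σ) :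
    ∃ C : ℝ, 0 ≤ C ∧ ∀ w : σ → k, ‖w‖ ≤ 1 → w i = 1 → 1 ≤ C * ‖fun j => eval w (P j)‖ := by
  have hX : (X i : MvPolynomial σ k) ∈ (Ideal.span (Set.range P)).radical := by
    rw [← vanishingIdeal_zeroLocus_eq_radical (K := k), zeroLocus_span]
    intro x hx
    have hx0 : x = 0 := hzero x fun j => by
      simpa [aeval_eq_eval] using hx (P j) ⟨j, rfl⟩
    simp [hx0]
  obtain ⟨m, hm⟩ := hX
  obtain ⟨A, hA⟩ := Ideal.mem_span_range_iff_exists_fun.mp hm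
  choose C hC0 hC using fun j => exists_norm_eval_le (A j)
  refine ⟨∑ j, C j, Finset.sum_nonneg fun j _ => hC0 j, fun w hw hwi => ?_⟩
  have h1 : ∑ j, eval w (A j) * eval w (P j) = 1 := by
    simpa [hwi] using congrArg (eval w) hA
  calc (1 : ℝ) = ‖∑ j, eval w (A j) * eval w (P j)‖ := by rw [h1, norm_one]
    _ ≤ ∑ j, C j * ‖fun j => eval w (P j)‖ := norm_sum_le_of_le _ fun j _ => by
        rw [norm_mul]
        exact mul_le_mul (hC j w hw) (norm_le_pi_norm (fun j => eval w (P j)) j)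
          (norm_nonneg _) (hC0 j)
    _ = _ := (Finset.sum_mul _ _ _).symm

end MvPolynomial

theorem exists_smul_eq_of_ne_zero {σ k : Type*} [Fintype σ] [NormedField k] {z : σ → k}
    (hz : z ≠ 0) :
    ∃ (c : k) (w : σ → k) (i : σ), c ≠ 0 ∧ ‖c‖ = ‖z‖ ∧ ‖w‖ = 1 ∧ w i = 1 ∧ z = c • w := by
  obtain ⟨j, hj⟩ := Function.ne_iff.mp hz
  have : Nonempty σ := ⟨j⟩
  obtain ⟨i, hi⟩ : ∃ i, ‖z i‖ = ‖z‖ := by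
    obtain ⟨i, hi⟩ := Finite.exists_max fun i => ‖z i‖
    exact ⟨i, (norm_le_pi_norm z i).antisymm ((pi_norm_le_iff_of_nonneg (norm_nonneg _)).2 hi)⟩
  have hzi : z i ≠ 0 := by
    rw [← norm_ne_zero_iff, hi]
    exact norm_ne_zero_iff.mpr hz
  refine ⟨z i, (z i)⁻¹ • z, i, hzi, hi, ?_, by simp [hzi], by simp [smul_smul, hzi]⟩
  rw [norm_smul, norm_inv, hi, inv_mul_cancel₀ (norm_ne_zero_iff.mpr hz)]

/-- A homogeneous polynomial map of degree `d` with no nontrivial zero distorts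
`log ‖z‖ ↦ d * log ‖z‖` by a bounded amount. -/
theorem exists_abs_log_norm_eval_sub_le {σ ι k : Type*} [Fintype σ] [Fintype ι] [NormedField k]
    [IsAlgClosed k] (P : ι → MvPolynomial σ k) {d : ℕ} (hhom : ∀ j, (P j).IsHomogeneous d)
    (hzero : ∀ z : σ → k, (∀ j, MvPolynomial.eval z (P j) = 0) → z = 0) :
    ∃ C : ℝ, ∀ z : σ → k, z ≠ 0 →
      |Real.log ‖fun j => MvPolynomial.eval z (P j)‖ - d * Real.log ‖z‖| ≤ C := by
  choose A hA0 hA using MvPolynomial.exists_one_le_mul_norm_eval P hzero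
  choose B hB0 hB using fun j => MvPolynomial.exists_norm_eval_le (P j)
  have hAs : 0 ≤ ∑ i, A i := Finset.sum_nonneg fun i _ => hA0 i
  have hBs : 0 ≤ ∑ j, B j := Finset.sum_nonneg fun j _ => hB0 j
  refine ⟨∑ i, A i + ∑ j, B j, fun z hz => ?_⟩
  obtain ⟨c, w, i, hc, hcz, hw, hwi, rfl⟩ := exists_smul_eq_of_ne_zero hz
  set f : ι → k := fun j => MvPolynomial.eval w (P j) with hf
  have hlow : 1 ≤ (∑ i, A i) * ‖f‖ := (hA i w hw.le hwi).trans <|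
    mul_le_mul_of_nonneg_right (Finset.single_le_sum (fun i _ => hA0 i) (Finset.mem_univ i))
      (norm_nonneg _)
  have hup : ‖f‖ ≤ ∑ j, B j := (pi_norm_le_iff_of_nonneg hBs).2 fun j =>
    (hB j w hw.le).trans (Finset.single_le_sum (fun j _ => hB0 j) (Finset.mem_univ j))
  have hf0 : 0 < ‖f‖ := by
    by_contra! h
    nlinarith [norm_nonneg f]
  have hA1 : 0 < ∑ i, A i := by
    by_contra! h
    nlinarith
  have hsmul : (fun j => MvPolynomial.eval (c • w) (P j)) = c ^ d • f := by
    ext j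
    simp [hf, (hhom j).eval_smul]
  have hlog : Real.log ‖c ^ d • f‖ - d * Real.log ‖c • w‖ = Real.log ‖f‖ := by
    rw [norm_smul, norm_smul, hw, mul_one, norm_pow,
      Real.log_mul (pow_ne_zero _ (norm_ne_zero_iff.mpr hc)) hf0.ne', Real.log_pow]
    ring
  rw [hsmul, hlog, abs_le]
  constructor
  · have h := Real.log_nonneg hlow
    rw [Real.log_mul hA1.ne' hf0.ne'] at h
    linarith [Real.log_le_self hAs]
  · linarith [Real.log_le_self hf0.le]

theorem iterate_smul_of_map_smul {k E : Type*} [Monoid k] [MulAction k E] {F : E → E} {d : ℕ}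
    (hF : ∀ (c : k) (z : E), F (c • z) = c ^ d • F z) (n : ℕ) (c : k) (z : E) :
    F^[n] (c • z) = c ^ d ^ n • F^[n] z := by
  induction n with
  | zero => simp
  | succ n ih => rw [Function.iterate_succ_apply', ih, hF, Function.iterate_succ_apply', ← pow_mul,
      ← pow_succ]

theorem iterate_ne_zero {E : Type*} [Zero E] {F : E → E} (hF : ∀ z, z ≠ 0 → F z ≠ 0) (n : ℕ)
    {z : E} (hz : z ≠ 0) : F^[n] z ≠ 0 := by
  induction n with
  | zero => simpa
  | succ n ih => rw [Function.iterate_succ_apply']; exact hF _ ih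

/-- Tate's telescoping argument: if `u` is multiplied by `d` under `F` up to a bounded error, then
`d⁻ⁿ * u (F^[n] z)` converges uniformly, to a function at bounded distance from `u`. -/
theorem exists_tendstoUniformlyOn_iterate {E : Type*} {F : E → E} {u : E → ℝ} {s : Set E}
    {d C : ℝ} (hd : 1 < d) (hs : Set.MapsTo F s s) (hu : ∀ z ∈ s, |u (F z) - d * u z| ≤ C) :
    ∃ G : E → ℝ, TendstoUniformlyOn (fun n z => (d ^ n)⁻¹ * u (F^[n] z)) G atTop s ∧
      ∃ B : ℝ, ∀ z ∈ s, |G z - u z| ≤ B := by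
  have hd0 : 0 < d := zero_lt_one.trans hd
  set v : ℕ → E → ℝ := fun n z =>
    (d ^ (n + 1))⁻¹ * u (F^[n + 1] z) - (d ^ n)⁻¹ * u (F^[n] z) with hv
  have hbound : ∀ n, ∀ z ∈ s, ‖v n z‖ ≤ C * d⁻¹ * d⁻¹ ^ n := by
    intro n z hz
    have h : v n z = (d⁻¹ * d⁻¹ ^ n) * (u (F (F^[n] z)) - d * u (F^[n] z)) := by
      simp only [hv, Function.iterate_succ_apply', inv_pow, pow_succ]
      field_simp
    rw [h, norm_mul, Real.norm_eq_abs, abs_of_nonneg (by positivity), mul_assoc C,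
      mul_comm C]
    exact mul_le_mul_of_nonneg_left (hu _ (hs.iterate n hz)) (by positivity)
  have hsum : Summable fun n : ℕ => C * d⁻¹ * d⁻¹ ^ n :=
    (summable_geometric_of_lt_one (by positivity) (inv_lt_one_of_one_lt₀ hd)).mul_left _
  refine ⟨fun z => u z + ∑' n, v n z, ?_, ∑' n : ℕ, C * d⁻¹ * d⁻¹ ^ n, fun z hz => ?_⟩
  · have h := tendstoUniformlyOn_tsum_nat hsum hbound
    rw [Metric.tendstoUniformlyOn_iff] at h ⊢
    intro ε hε
    filter_upwards [h ε hε] with n hn z hz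
    have htel : (d ^ n)⁻¹ * u (F^[n] z) = u z + ∑ i ∈ Finset.range n, v i z := by
      simp only [hv]
      rw [Finset.sum_range_sub fun i => (d ^ i)⁻¹ * u (F^[i] z)]
      simp
    rw [htel, dist_add_left]
    exact hn z hz
  · rw [add_sub_cancel_left]
    exact tsum_of_norm_bounded hsum.hasSum fun n => hbound n z hz

/-- Kawaguchi–Silverman Green function: over an algebraically closed, complete,
nontrivially valued non-Archimedean field `k`, given homogeneous polynomials
`P 0, …, P N` of degree `d ≥ 2` with coefficients of absolute value at most `1`
whose only common zero is the origin, the functions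
`G n z = d⁻ⁿ · log ‖F^[n] z‖` converge uniformly on `k^{N+1} \ {0}` to a
function `G` that is continuous, satisfies `G (λ • z) = G z + log |λ|`, and
stays at bounded distance from `log ‖z‖`. -/
theorem stmt0 {k : Type*} [NormedField k] [IsUltrametricDist k]
    [CompleteSpace k] [IsAlgClosed k]
    (ht : ∃ t : k, 0 < ‖t‖ ∧ ‖t‖ < 1)
    (N d : ℕ) (hd : 2 ≤ d)
    (P : Fin (N + 1) → MvPolynomial (Fin (N + 1)) k)
    (hhom : ∀ i, (P i).IsHomogeneous d)
    (hcoeff : ∀ i m, ‖(P i).coeff m‖ ≤ 1)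
    (hzero : ∀ z : Fin (N + 1) → k, (∀ i, MvPolynomial.eval z (P i) = 0) → z = 0)
    (F : (Fin (N + 1) → k) → (Fin (N + 1) → k))
    (hF : ∀ z i, F z i = MvPolynomial.eval z (P i)) :
    ∃ G : (Fin (N + 1) → k) → ℝ,
      TendstoUniformlyOn
        (fun n z => ((d : ℝ) ^ n)⁻¹ * Real.log ‖F^[n] z‖) G atTop
        {z : Fin (N + 1) → k | z ≠ 0} ∧
      ContinuousOn G {z : Fin (N + 1) → k | z ≠ 0} ∧
      (∀ lam : k, lam ≠ 0 → ∀ z : Fin (N + 1) → k, z ≠ 0 →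
        G (lam • z) = G z + Real.log ‖lam‖) ∧
      ∃ C : ℝ, ∀ z : Fin (N + 1) → k, z ≠ 0 → |G z - Real.log ‖z‖| ≤ C := by
  have hF' : ∀ z, F z = fun j => MvPolynomial.eval z (P j) := fun z => funext (hF z)
  have hne : ∀ z, z ≠ 0 → F z ≠ 0 := fun z hz h =>
    hz (hzero z fun i => by rw [← hF, h, Pi.zero_apply])
  have hsmul : ∀ (c : k) z, F (c • z) = c ^ d • F z := fun c z => by
    ext i
    simp [hF, (hhom i).eval_smul]
  have hcont : Continuous F := continuous_pi fun i => by
    simpa only [hF] using MvPolynomial.continuous_eval (P i)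
  obtain ⟨C, hC⟩ := exists_abs_log_norm_eval_sub_le P hhom hzero
  have hd1 : (1 : ℝ) < d := by exact_mod_cast hd
  obtain ⟨G, hG, B, hB⟩ := exists_tendstoUniformlyOn_iterate
    (u := fun z => Real.log ‖z‖) (s := {z : Fin (N + 1) → k | z ≠ 0}) hd1
    (fun z hz => hne z hz) (fun z hz => by simpa only [hF'] using hC z hz)
  refine ⟨G, hG, ?_, ?_, B, hB⟩
  · refine hG.continuousOn (Frequently.of_forall fun n => ?_)
    exact continuousOn_const.mul ((hcont.iterate n).norm.continuousOn.log fun z hz =>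
      norm_ne_zero_iff.mpr (iterate_ne_zero hne n hz))
  · intro c hc z hz
    refine tendsto_nhds_unique (hG.tendsto_at (smul_ne_zero hc hz))
      (((hG.tendsto_at hz).add_const (Real.log ‖c‖)).congr fun n => ?_)
    have hdn : (d : ℝ) ^ n ≠ 0 := pow_ne_zero _ (by positivity)
    rw [iterate_smul_of_map_smul hsmul, norm_smul, norm_pow,
      Real.log_mul (pow_ne_zero _ (norm_ne_zero_iff.mpr hc))
        (norm_ne_zero_iff.mpr (iterate_ne_zero hne n hz)), Real.log_pow]
    push_cast
    field_simp
    ring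
end

section
/- Let d ≥ 1 and let F_1, …, F_m ∈ k[T_1, …, T_n] be homogeneous polynomials of degree d whose only common zero in k^n is the origin. Then there exists a real constant C > 0 such that for every z ∈ k^n one has C · ‖z‖^d ≤ max_{1 ≤ i ≤ m} |F_i(z)|. -/
open MvPolynomial in
theorem MvPolynomial.IsHomogeneous.eval_smul_eq {σ R : Type*} [CommSemiring R]
    {p : MvPolynomial σ R} {d : ℕ} (hp : p.IsHomogeneous d) (c : R) (x : σ → R) :
    eval (c • x) p = c ^ d * eval x p := by
  rw [eval_eq, eval_eq, Finset.mul_sum]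
  refine Finset.sum_congr rfl fun s hs => ?_
  have hdeg : ∑ i ∈ s.support, s i = d := by
    rw [← hp (mem_support_iff.mp hs), Finsupp.weight_apply]
    simp [Finsupp.sum]
  simp only [Pi.smul_apply, smul_eq_mul, mul_pow, Finset.prod_mul_distrib,
    Finset.prod_pow_eq_pow_sum, hdeg]
  ring

open MvPolynomial in
theorem MvPolynomial.norm_eval_le_sum_norm_coeff {σ k : Type*} [Fintype σ] [NormedField k]
    (p : MvPolynomial σ k) {x : σ → k} (hx : ‖x‖ ≤ 1) :
    ‖eval x p‖ ≤ ∑ s ∈ p.support, ‖coeff s p‖ := by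
  rw [eval_eq]
  refine norm_sum_le_of_le _ fun s _ => ?_
  rw [norm_mul, norm_prod]
  refine mul_le_of_le_one_right (norm_nonneg _) (Finset.prod_le_one (fun _ _ => norm_nonneg _) ?_)
  intro i _
  rw [norm_pow]
  exact pow_le_one₀ (norm_nonneg _) ((norm_le_pi_norm x i).trans hx)

open MvPolynomial in
theorem MvPolynomial.exists_X_pow_mem_span_of_forall_eval_eq_zero {σ k ι : Type*} [Finite σ]
    [Field k] [IsAlgClosed k] (F : ι → MvPolynomial σ k)
    (hF : ∀ x : σ → k, (∀ i, eval x (F i) = 0) → x = 0) (a : σ) :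
    ∃ N : ℕ, (X a : MvPolynomial σ k) ^ N ∈ Ideal.span (Set.range F) := by
  suffices h : (X a : MvPolynomial σ k) ∈ (Ideal.span (Set.range F)).radical from h
  rw [← vanishingIdeal_zeroLocus_eq_radical (K := k), mem_vanishingIdeal_iff]
  intro x hx
  rw [zeroLocus_span] at hx
  have hx0 : x = 0 := hF x fun i => by simpa [aeval_eq_eval] using hx (F i) ⟨i, rfl⟩
  simp [hx0]

/-- If homogeneous polynomials of degree `d ≥ 1` over an algebraically closed
non-Archimedean valued field have the origin as their only common zero, then
`C · ‖z‖ ^ d ≤ max_i |F i (z)|` for some constant `C > 0`. -/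
theorem stmt2 {k : Type*} [NormedField k] [IsUltrametricDist k] [IsAlgClosed k]
    (n m d : ℕ) (hd : 1 ≤ d)
    (F : Fin m → MvPolynomial (Fin n) k)
    (hhom : ∀ i, (F i).IsHomogeneous d)
    (hzero : ∀ x : Fin n → k, (∀ i, MvPolynomial.eval x (F i) = 0) → x = 0) :
    ∃ C : ℝ, 0 < C ∧ ∀ z : Fin n → k,
      C * ‖z‖ ^ d ≤ ⨆ i : Fin m, ‖MvPolynomial.eval z (F i)‖ := by
  choose N hN using MvPolynomial.exists_X_pow_mem_span_of_forall_eval_eq_zero F hzero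
  choose G hG using fun a => Ideal.mem_span_range_iff_exists_fun.mp (hN a)
  let b (a : Fin n) (j : Fin m) : ℝ := ∑ s ∈ (G a j).support, ‖(G a j).coeff s‖
  have hb (a j) : 0 ≤ b a j := Finset.sum_nonneg fun _ _ => norm_nonneg _
  have hB : 0 ≤ ∑ a, ∑ j, b a j := Finset.sum_nonneg fun a _ => Finset.sum_nonneg fun j _ => hb a j
  set B := ∑ a, ∑ j, b a j
  have hsup (z : Fin n → k) : 0 ≤ ⨆ i, ‖MvPolynomial.eval z (F i)‖ :=
    Real.iSup_nonneg fun _ => norm_nonneg _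
  refine ⟨(B + 1)⁻¹, by positivity, fun z => ?_⟩
  rw [inv_mul_le_iff₀ (by positivity)]
  rcases eq_or_ne z 0 with rfl | hz
  · rw [norm_zero, zero_pow (by omega)]
    exact mul_nonneg (by positivity) (hsup 0)
  obtain ⟨c, hc⟩ := Function.ne_iff.mp hz
  have : Nonempty (Fin n) := ⟨c⟩
  obtain ⟨a, ha⟩ : ∃ a, ‖z a‖ = ‖z‖ := by
    obtain ⟨a, ha⟩ := Finite.exists_max fun i => ‖z i‖
    exact ⟨a, le_antisymm (norm_le_pi_norm z a)
      ((pi_norm_le_iff_of_nonneg (norm_nonneg _)).mpr ha)⟩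
  have hza : z a ≠ 0 := by rw [← norm_ne_zero_iff, ha]; exact norm_ne_zero_iff.mpr hz
  set w : Fin n → k := (z a)⁻¹ • z with hw_def
  have hw : ‖w‖ ≤ 1 := by
    rw [hw_def, norm_smul, norm_inv, ha, inv_mul_cancel₀ (norm_ne_zero_iff.mpr hz)]
  have hzw : z = z a • w := by rw [hw_def, smul_inv_smul₀ hza]
  have hone : ∑ j, MvPolynomial.eval w (G a j) * MvPolynomial.eval w (F j) = 1 := by
    have h := congrArg (MvPolynomial.eval w) (hG a)
    rw [map_sum, map_pow, MvPolynomial.eval_X, hw_def, Pi.smul_apply, smul_eq_mul,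
      inv_mul_cancel₀ hza, one_pow] at h
    simpa only [map_mul] using h
  calc ‖z‖ ^ d = ‖z a‖ ^ d * ‖∑ j, MvPolynomial.eval w (G a j) * MvPolynomial.eval w (F j)‖ := by
        rw [hone, norm_one, mul_one, ha]
    _ = ‖∑ j, MvPolynomial.eval w (G a j) * MvPolynomial.eval z (F j)‖ := by
        rw [← norm_pow, ← norm_mul, Finset.mul_sum]
        congr 1
        refine Finset.sum_congr rfl fun j _ => ?_
        conv_rhs => rw [hzw, (hhom j).eval_smul_eq]
        ring
    _ ≤ ∑ j, b a j * ⨆ i, ‖MvPolynomial.eval z (F i)‖ := by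
        refine norm_sum_le_of_le _ fun j _ => ?_
        rw [norm_mul]
        exact mul_le_mul (MvPolynomial.norm_eval_le_sum_norm_coeff _ hw)
          (le_ciSup (f := fun i => ‖MvPolynomial.eval z (F i)‖) (Set.finite_range _).bddAbove j)
          (norm_nonneg _) (hb a j)
    _ = (∑ j, b a j) * ⨆ i, ‖MvPolynomial.eval z (F i)‖ := (Finset.sum_mul ..).symm
    _ ≤ (B + 1) * ⨆ i, ‖MvPolynomial.eval z (F i)‖ := by
        refine mul_le_mul_of_nonneg_right ?_ (hsup z)
        have := Finset.single_le_sum (f := fun a => ∑ j, b a j)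
          (fun a _ => Finset.sum_nonneg fun j _ => hb a j) (Finset.mem_univ a)
        linarith
end

section
/- There exists a function G : E \ {0} → ℝ such that |G(z) − G_n(z)| ≤ |log c| / d^n for every integer n ≥ 0 and every z ∈ E with z ≠ 0; in particular, the sequence of functions (G_n) converges uniformly on E \ {0} to G. -/
open Filter

/-- A real sequence whose consecutive increments are at most `L / d ^ (n + 1)`, with `2 ≤ d`,
converges, and its `n`-th term is within `L / d ^ n` of the limit. -/
theorem exists_tendsto_of_abs_sub_succ_le {u : ℕ → ℝ} {d L : ℝ} (hd : 2 ≤ d) (hL : 0 ≤ L)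
    (hu : ∀ n, |u n - u (n + 1)| ≤ L / d ^ (n + 1)) :
    ∃ a, Tendsto u atTop (nhds a) ∧ ∀ n, |a - u n| ≤ L / d ^ n := by
  have hd0 : 0 < d := by linarith
  have hinv : d⁻¹ ≤ 2⁻¹ := inv_anti₀ two_pos hd
  have hr : d⁻¹ < 1 := by linarith
  have hgeom : ∀ n, dist (u n) (u (n + 1)) ≤ L * (1 - d⁻¹) * d⁻¹ ^ n := fun n => by
    rw [Real.dist_eq]
    calc |u n - u (n + 1)| ≤ L * d⁻¹ * d⁻¹ ^ n := by
          refine (hu n).trans_eq ?_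
          rw [div_eq_mul_inv, ← inv_pow, pow_succ]
          ring
      _ ≤ L * (1 - d⁻¹) * d⁻¹ ^ n := by
          gcongr
          linarith
  obtain ⟨a, ha⟩ := cauchySeq_tendsto_of_complete (cauchySeq_of_le_geometric _ _ hr hgeom)
  refine ⟨a, ha, fun n => ?_⟩
  have h := dist_le_of_le_geometric_of_tendsto _ _ hr hgeom ha n
  rw [dist_comm, Real.dist_eq] at h
  refine h.trans_eq ?_
  have h1 : 1 - d⁻¹ ≠ 0 := by linarith
  rw [mul_right_comm, mul_div_assoc, div_self h1, mul_one, inv_pow, div_eq_mul_inv]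

/-- If `c * x ^ d ≤ y ≤ x ^ d` with `x > 0` and `0 < c ≤ 1`, then `log y` differs from `d * log x`
by at most `|log c|`. -/
theorem abs_mul_log_sub_log_le {c x y : ℝ} {d : ℕ} (hc0 : 0 < c) (hc1 : c ≤ 1) (hx : 0 < x)
    (hl : c * x ^ d ≤ y) (hr : y ≤ x ^ d) :
    |d * Real.log x - Real.log y| ≤ |Real.log c| := by
  have hxd : 0 < x ^ d := pow_pos hx d
  have hcx : 0 < c * x ^ d := mul_pos hc0 hxd
  have h1 := Real.log_le_log hcx hl
  have h2 := Real.log_le_log (hcx.trans_le hl) hr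
  rw [Real.log_mul hc0.ne' hxd.ne', Real.log_pow] at h1
  rw [Real.log_pow] at h2
  rw [abs_of_nonpos (Real.log_nonpos hc0.le hc1), abs_of_nonneg (by linarith)]
  linarith

/-- There exists a function `G` on `E \ {0}` with
`|G z - G n z| ≤ |log c| / d^n` for all `n` and `z ≠ 0`; in particular the
`G n` converge uniformly to `G` on `E \ {0}`. -/
theorem stmt5 {k : Type*} [NormedField k] (N : ℕ)
    (d : ℕ) (hd : 2 ≤ d) (c : ℝ) (hc0 : 0 < c) (hc1 : c ≤ 1)
    (F : (Fin (N + 1) → k) → (Fin (N + 1) → k))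
    (hF : ∀ z : Fin (N + 1) → k, z ≠ 0 →
      c * ‖z‖ ^ d ≤ ‖F z‖ ∧ ‖F z‖ ≤ ‖z‖ ^ d) :
    ∃ G : (Fin (N + 1) → k) → ℝ,
      (∀ (n : ℕ) (z : Fin (N + 1) → k), z ≠ 0 →
        |G z - ((d : ℝ) ^ n)⁻¹ * Real.log ‖F^[n] z‖| ≤ |Real.log c| / (d : ℝ) ^ n) ∧
      TendstoUniformlyOn
        (fun n z => ((d : ℝ) ^ n)⁻¹ * Real.log ‖F^[n] z‖) G atTop
        {z : Fin (N + 1) → k | z ≠ 0} := by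
  have hd2 : (2 : ℝ) ≤ d := by exact_mod_cast hd
  have hd0 : (0 : ℝ) < d := by linarith
  have hne : ∀ z : Fin (N + 1) → k, z ≠ 0 → F z ≠ 0 := fun z hz =>
    norm_pos_iff.1 ((mul_pos hc0 (pow_pos (norm_pos_iff.2 hz) d)).trans_le (hF z hz).1)
  have hiter : ∀ (n : ℕ) (z : Fin (N + 1) → k), z ≠ 0 → F^[n] z ≠ 0 := fun n z hz => by
    induction n with
    | zero => exact hz
    | succ n ih =>
      rw [Function.iterate_succ_apply']
      exact hne _ ih
  have hlim : ∀ z : Fin (N + 1) → k, ∃ a : ℝ, z ≠ 0 → ∀ n : ℕ,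
      |a - ((d : ℝ) ^ n)⁻¹ * Real.log ‖F^[n] z‖| ≤ |Real.log c| / (d : ℝ) ^ n := fun z => by
    by_cases hz : z = 0
    · exact ⟨0, fun h => absurd hz h⟩
    obtain ⟨a, -, ha⟩ := exists_tendsto_of_abs_sub_succ_le
      (u := fun n => ((d : ℝ) ^ n)⁻¹ * Real.log ‖F^[n] z‖) hd2 (abs_nonneg (Real.log c))
      fun n => by
        have hw := hiter n z hz
        have h := abs_mul_log_sub_log_le hc0 hc1 (norm_pos_iff.2 hw) (hF _ hw).1 (hF _ hw).2
        have heq : ((d : ℝ) ^ n)⁻¹ * Real.log ‖F^[n] z‖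
            - ((d : ℝ) ^ (n + 1))⁻¹ * Real.log ‖F^[n + 1] z‖
            = (d * Real.log ‖F^[n] z‖ - Real.log ‖F (F^[n] z)‖) / (d : ℝ) ^ (n + 1) := by
          rw [Function.iterate_succ_apply']
          field_simp
          ring
        rw [heq, abs_div, abs_of_pos (pow_pos hd0 (n + 1))]
        gcongr
    exact ⟨a, fun _ => ha⟩
  choose G hG using hlim
  refine ⟨G, fun n z hz => hG z hz n, Metric.tendstoUniformlyOn_iff.2 fun ε hε => ?_⟩
  have htend : Tendsto (fun n : ℕ => |Real.log c| / (d : ℝ) ^ n) atTop (nhds 0) :=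
    (tendsto_pow_atTop_atTop_of_one_lt (by linarith)).const_div_atTop _
  filter_upwards [htend.eventually_lt_const hε] with n hn z hz
  rw [Real.dist_eq]
  exact (hG z hz n).trans_lt hn
end

section
/- Assume in addition that F(a·z) = a^d·F(z) for every scalar a ∈ k and every z ∈ E. If G : E \ {0} → ℝ is any function such that G_n(z) → G(z) as n → ∞ for every z ≠ 0, then G(a·z) = G(z) + log|a| for every a ∈ k with a ≠ 0 and every z ∈ E with z ≠ 0. -/
open Filter

/-- Iterates of a map homogeneous of degree `d` are homogeneous of degree `d ^ n`. -/
theorem iterate_smul_of_homogeneous {M E : Type*} [Monoid M] [MulAction M E] {d : ℕ}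
    {F : E → E} (hhom : ∀ (a : M) (z : E), F (a • z) = a ^ d • F z) (n : ℕ) (a : M) (z : E) :
    F^[n] (a • z) = a ^ d ^ n • F^[n] z := by
  induction n with
  | zero => simp
  | succ n ih => rw [Function.iterate_succ_apply', Function.iterate_succ_apply', ih, hhom,
      ← pow_mul, ← pow_succ]

/-- If moreover `F (a • z) = a ^ d • F z`, then any pointwise limit `G` of the
`G n` on `E \ {0}` satisfies `G (a • z) = G z + log |a|` for `a ≠ 0`, `z ≠ 0`. -/
theorem stmt6 {k : Type*} [NormedField k] (N : ℕ)
    (d : ℕ) (hd : 2 ≤ d) (c : ℝ) (hc0 : 0 < c) (hc1 : c ≤ 1)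
    (F : (Fin (N + 1) → k) → (Fin (N + 1) → k))
    (hF : ∀ z : Fin (N + 1) → k, z ≠ 0 →
      c * ‖z‖ ^ d ≤ ‖F z‖ ∧ ‖F z‖ ≤ ‖z‖ ^ d)
    (hhom : ∀ (a : k) (z : Fin (N + 1) → k), F (a • z) = a ^ d • F z)
    (G : (Fin (N + 1) → k) → ℝ)
    (hG : ∀ z : Fin (N + 1) → k, z ≠ 0 →
      Tendsto (fun n => ((d : ℝ) ^ n)⁻¹ * Real.log ‖F^[n] z‖) atTop (nhds (G z))) :
    ∀ a : k, a ≠ 0 → ∀ z : Fin (N + 1) → k, z ≠ 0 →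
      G (a • z) = G z + Real.log ‖a‖ := by
  intro a ha z hz
  have hne : ∀ w, w ≠ 0 → F w ≠ 0 := fun w hw =>
    norm_pos_iff.mp ((mul_pos hc0 (pow_pos (norm_pos_iff.mpr hw) d)).trans_le (hF w hw).1)
  refine tendsto_nhds_unique (hG (a • z) (smul_ne_zero ha hz))
    (((hG z hz).add_const (Real.log ‖a‖)).congr fun n => ?_)
  have hd0 : (d : ℝ) ^ n ≠ 0 := pow_ne_zero n (by positivity)
  rw [iterate_smul_of_homogeneous hhom, norm_smul, norm_pow,
    Real.log_mul (pow_ne_zero _ (norm_ne_zero_iff.mpr ha))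
      (norm_ne_zero_iff.mpr (iterate_ne_zero hne n hz)), Real.log_pow]
  push_cast
  field_simp
  ring
end

section
/- If G : E \ {0} → ℝ is any function such that G_n(z) → G(z) as n → ∞ for every z ≠ 0, then |G(z) − log ‖z‖| ≤ |log c| for every z ∈ E with z ≠ 0. -/
open Filter

theorem abs_log_norm_map_sub_le {E : Type*} [NormedAddCommGroup E] {d : ℕ} {c : ℝ}
    (hc0 : 0 < c) {F : E → E} {z : E} (hz : z ≠ 0)
    (hF : c * ‖z‖ ^ d ≤ ‖F z‖ ∧ ‖F z‖ ≤ ‖z‖ ^ d) :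
    |Real.log ‖F z‖ - d * Real.log ‖z‖| ≤ |Real.log c| := by
  have hpow : 0 < ‖z‖ ^ d := pow_pos (norm_pos_iff.mpr hz) d
  have hlow : 0 < c * ‖z‖ ^ d := mul_pos hc0 hpow
  have h1 := Real.log_le_log hlow hF.1
  have h2 := Real.log_le_log (hlow.trans_le hF.1) hF.2
  rw [Real.log_mul hc0.ne' hpow.ne', Real.log_pow] at h1
  rw [Real.log_pow] at h2
  rw [abs_le]
  constructor
  · linarith [neg_abs_le (Real.log c)]
  · linarith [abs_nonneg (Real.log c)]

theorem iterate_ne_zero_of_le_norm {E : Type*} [NormedAddCommGroup E] {d : ℕ} {c : ℝ}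
    (hc0 : 0 < c) {F : E → E} (hF : ∀ z : E, z ≠ 0 → c * ‖z‖ ^ d ≤ ‖F z‖)
    {z : E} (hz : z ≠ 0) (n : ℕ) : F^[n] z ≠ 0 := by
  induction n with
  | zero => simpa using hz
  | succ n ih =>
    rw [Function.iterate_succ_apply']
    exact norm_pos_iff.mp
      ((mul_pos hc0 (pow_pos (norm_pos_iff.mpr ih) d)).trans_le (hF _ ih))

theorem abs_escape_rate_sub_log_norm_le {E : Type*} [NormedAddCommGroup E] {d : ℕ} {c : ℝ}
    (hd : 2 ≤ d) (hc0 : 0 < c) {F : E → E}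
    (hF : ∀ z : E, z ≠ 0 → c * ‖z‖ ^ d ≤ ‖F z‖ ∧ ‖F z‖ ≤ ‖z‖ ^ d)
    {z : E} (hz : z ≠ 0) (n : ℕ) :
    |((d : ℝ) ^ n)⁻¹ * Real.log ‖F^[n] z‖ - Real.log ‖z‖| ≤
      |Real.log c| * (1 - ((d : ℝ) ^ n)⁻¹) := by
  induction n with
  | zero => simp
  | succ n ih =>
    have hd' : (2 : ℝ) ≤ d := by exact_mod_cast hd
    have hd0 : (d : ℝ) ≠ 0 := by positivity
    have hstep := abs_log_norm_map_sub_le hc0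
      (iterate_ne_zero_of_le_norm hc0 (fun w hw => (hF w hw).1) hz n)
      (hF _ (iterate_ne_zero_of_le_norm hc0 (fun w hw => (hF w hw).1) hz n))
    rw [← Function.iterate_succ_apply' F n z] at hstep
    set r := ((d : ℝ) ^ (n + 1))⁻¹ with hr
    have hr0 : 0 ≤ r := by positivity
    have hrn : ((d : ℝ) ^ n)⁻¹ = d * r := by
      rw [hr, pow_succ]
      field_simp
    rw [hrn] at ih
    have hsplit : r * Real.log ‖F^[n + 1] z‖ - Real.log ‖z‖ =
        r * (Real.log ‖F^[n + 1] z‖ - d * Real.log ‖F^[n] z‖) +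
          (d * r * Real.log ‖F^[n] z‖ - Real.log ‖z‖) := by ring
    calc |r * Real.log ‖F^[n + 1] z‖ - Real.log ‖z‖|
        ≤ r * |Real.log ‖F^[n + 1] z‖ - d * Real.log ‖F^[n] z‖| +
          |d * r * Real.log ‖F^[n] z‖ - Real.log ‖z‖| := by
          rw [hsplit]
          refine (abs_add_le _ _).trans_eq ?_
          rw [abs_mul, abs_of_nonneg hr0]
      _ ≤ r * |Real.log c| + |Real.log c| * (1 - d * r) := by gcongr
      _ ≤ |Real.log c| * (1 - r) := by
          nlinarith [mul_nonneg (mul_nonneg (abs_nonneg (Real.log c)) hr0) (sub_nonneg.mpr hd')]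

/-- Any pointwise limit `G` of the `G n` on `E \ {0}` satisfies
`|G z - log ‖z‖| ≤ |log c|`. -/
theorem stmt7 {k : Type*} [NormedField k] (N : ℕ)
    (d : ℕ) (hd : 2 ≤ d) (c : ℝ) (hc0 : 0 < c) (hc1 : c ≤ 1)
    (F : (Fin (N + 1) → k) → (Fin (N + 1) → k))
    (hF : ∀ z : Fin (N + 1) → k, z ≠ 0 →
      c * ‖z‖ ^ d ≤ ‖F z‖ ∧ ‖F z‖ ≤ ‖z‖ ^ d)
    (G : (Fin (N + 1) → k) → ℝ)
    (hG : ∀ z : Fin (N + 1) → k, z ≠ 0 →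
      Tendsto (fun n => ((d : ℝ) ^ n)⁻¹ * Real.log ‖F^[n] z‖) atTop (nhds (G z))) :
    ∀ z : Fin (N + 1) → k, z ≠ 0 → |G z - Real.log ‖z‖| ≤ |Real.log c| := by
  intro z hz
  refine le_of_tendsto ((hG z hz).sub_const _).abs (Eventually.of_forall fun n => ?_)
  refine (abs_escape_rate_sub_log_norm_le hd hc0 hF hz n).trans ?_
  refine mul_le_of_le_one_right (abs_nonneg _) (sub_le_self _ ?_)
  positivity
end

section
/- Assume in addition that F is continuous. If G : E \ {0} → ℝ is any function such that G_n(z) → G(z) as n → ∞ for every z ≠ 0, then G is continuous on E \ {0}. -/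
open Filter

section HomogeneousGrowth

variable {E : Type*} [NormedAddCommGroup E] {F : E → E} {d : ℕ} {c : ℝ}

lemma iterate_ne_zero_of_ne_zero (hF0 : ∀ z, z ≠ 0 → F z ≠ 0) {z : E} (hz : z ≠ 0) (n : ℕ) :
    F^[n] z ≠ 0 := by
  induction n with
  | zero => exact hz
  | succ n ih => rw [Function.iterate_succ_apply']; exact hF0 _ ih

lemma abs_log_norm_sub_le (hc0 : 0 < c) {z : E} (hz : z ≠ 0)
    (hl : c * ‖z‖ ^ d ≤ ‖F z‖) (hu : ‖F z‖ ≤ ‖z‖ ^ d) :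
    |d * Real.log ‖z‖ - Real.log ‖F z‖| ≤ -Real.log c := by
  have hpow : 0 < ‖z‖ ^ d := pow_pos (norm_pos_iff.2 hz) d
  have hpos : 0 < ‖F z‖ := (mul_pos hc0 hpow).trans_le hl
  have h₁ := Real.log_le_log (mul_pos hc0 hpow) hl
  have h₂ := Real.log_le_log hpos hu
  rw [Real.log_mul hc0.ne' hpow.ne'] at h₁
  rw [Real.log_pow] at h₁ h₂
  rw [abs_le]
  constructor <;> linarith

lemma dist_log_norm_iterate_le (hd : d ≠ 0) (hc0 : 0 < c)
    (hF : ∀ z, z ≠ 0 → c * ‖z‖ ^ d ≤ ‖F z‖ ∧ ‖F z‖ ≤ ‖z‖ ^ d)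
    (hF0 : ∀ z, z ≠ 0 → F z ≠ 0) {z : E} (hz : z ≠ 0) (n : ℕ) :
    dist (((d : ℝ) ^ n)⁻¹ * Real.log ‖F^[n] z‖) (((d : ℝ) ^ (n + 1))⁻¹ * Real.log ‖F^[n + 1] z‖) ≤
      (d : ℝ)⁻¹ * -Real.log c * (d : ℝ)⁻¹ ^ n := by
  have hw := iterate_ne_zero_of_ne_zero hF0 hz n
  have hd' : (d : ℝ) ≠ 0 := Nat.cast_ne_zero.2 hd
  have key := abs_log_norm_sub_le hc0 hw (hF _ hw).1 (hF _ hw).2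
  have heq : ((d : ℝ) ^ n)⁻¹ * Real.log ‖F^[n] z‖ -
      ((d : ℝ) ^ (n + 1))⁻¹ * Real.log ‖F (F^[n] z)‖ =
      ((d : ℝ) ^ (n + 1))⁻¹ * (d * Real.log ‖F^[n] z‖ - Real.log ‖F (F^[n] z)‖) := by
    field_simp
    ring
  rw [Function.iterate_succ_apply', Real.dist_eq, heq, abs_mul,
    abs_of_nonneg (by positivity : (0 : ℝ) ≤ ((d : ℝ) ^ (n + 1))⁻¹)]
  calc _ ≤ ((d : ℝ) ^ (n + 1))⁻¹ * -Real.log c := by gcongr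
    _ = _ := by rw [← inv_pow, pow_succ]; ring

lemma tendstoUniformlyOn_log_norm_iterate (hd : 2 ≤ d) (hc0 : 0 < c)
    (hF : ∀ z, z ≠ 0 → c * ‖z‖ ^ d ≤ ‖F z‖ ∧ ‖F z‖ ≤ ‖z‖ ^ d)
    (hF0 : ∀ z, z ≠ 0 → F z ≠ 0) {G : E → ℝ}
    (hG : ∀ z, z ≠ 0 →
      Tendsto (fun n => ((d : ℝ) ^ n)⁻¹ * Real.log ‖F^[n] z‖) atTop (nhds (G z))) :
    TendstoUniformlyOn (fun n z => ((d : ℝ) ^ n)⁻¹ * Real.log ‖F^[n] z‖) G atTop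
      {z : E | z ≠ 0} := by
  have hr : (d : ℝ)⁻¹ < 1 := inv_lt_one_of_one_lt₀ (by exact_mod_cast hd)
  have hlim : Tendsto
      (fun n : ℕ => (d : ℝ)⁻¹ * -Real.log c * (d : ℝ)⁻¹ ^ n / (1 - (d : ℝ)⁻¹)) atTop (nhds 0) := by
    simpa using ((tendsto_pow_atTop_nhds_zero_of_lt_one (by positivity) hr).const_mul
      ((d : ℝ)⁻¹ * -Real.log c)).div_const (1 - (d : ℝ)⁻¹)
  rw [Metric.tendstoUniformlyOn_iff]
  intro ε hε
  filter_upwards [hlim.eventually_lt_const hε] with n hn z hz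
  rw [dist_comm]
  exact (dist_le_of_le_geometric_of_tendsto _ _ hr
    (dist_log_norm_iterate_le (by lia) hc0 hF hF0 hz) (hG z hz) n).trans_lt hn

end HomogeneousGrowth

/-- If `F` is continuous, any pointwise limit `G` of the `G n` on `E \ {0}` is
continuous on `E \ {0}`. -/
theorem stmt8 {k : Type*} [NormedField k] (N : ℕ)
    (d : ℕ) (hd : 2 ≤ d) (c : ℝ) (hc0 : 0 < c) (hc1 : c ≤ 1)
    (F : (Fin (N + 1) → k) → (Fin (N + 1) → k))
    (hF : ∀ z : Fin (N + 1) → k, z ≠ 0 →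
      c * ‖z‖ ^ d ≤ ‖F z‖ ∧ ‖F z‖ ≤ ‖z‖ ^ d)
    (hcont : Continuous F)
    (G : (Fin (N + 1) → k) → ℝ)
    (hG : ∀ z : Fin (N + 1) → k, z ≠ 0 →
      Tendsto (fun n => ((d : ℝ) ^ n)⁻¹ * Real.log ‖F^[n] z‖) atTop (nhds (G z))) :
    ContinuousOn G {z : Fin (N + 1) → k | z ≠ 0} := by
  have hF0 : ∀ z, z ≠ 0 → F z ≠ 0 := fun z hz => norm_pos_iff.1 <|
    (mul_pos hc0 (pow_pos (norm_pos_iff.2 hz) d)).trans_le (hF z hz).1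
  refine (tendstoUniformlyOn_log_norm_iterate hd hc0 hF hF0 hG).continuousOn
    (Eventually.frequently (Eventually.of_forall fun n => ?_))
  exact continuousOn_const.mul ((hcont.iterate n).norm.continuousOn.log fun z hz =>
    norm_ne_zero_iff.2 (iterate_ne_zero_of_ne_zero hF0 hz n))
end

section
/- Let r ≥ 1 and let a : ℕ^r → K be a family of coefficients with |a_I| ≤ 1 for every multi-index I. Suppose that for every z = (z_1, …, z_r) with all z_i ∈ k and |z_i| < 1 for all i, the convergent sum ∑_{I ∈ ℕ^r} a_I · z^I equals 0 (the family is summable in K since |a_I z^I| → 0 along the cofinite filter on ℕ^r). Then a_I = 0 for every I ∈ ℕ^r. -/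
open Filter in
/-- In an ultrametric group, a sum of terms of norm at most `C` has norm at most `C`. -/
theorem HasSum.norm_le_of_forall_norm_le {ι E : Type*} [SeminormedAddCommGroup E]
    [IsUltrametricDist E] {f : ι → E} {s : E} (hf : HasSum f s) {C : ℝ} (hC : 0 ≤ C)
    (h : ∀ i, ‖f i‖ ≤ C) : ‖s‖ ≤ C :=
  le_of_tendsto hf.norm (Eventually.of_forall fun _ ↦
    IsUltrametricDist.norm_sum_le_of_forall_le_of_nonneg hC fun i _ ↦ h i)

open Filter in
/-- A power series in one variable with coefficients of norm at most `1` which vanishes at all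
positive powers of some `t ≠ 0` with `‖t‖ < 1` is zero. -/
theorem eq_zero_of_hasSum_pow_eq_zero {K : Type*} [NormedField K] [IsUltrametricDist K]
    {t : K} (ht0 : 0 < ‖t‖) (ht1 : ‖t‖ < 1) {c : ℕ → K} (hc : ∀ n, ‖c n‖ ≤ 1)
    (h : ∀ m, 1 ≤ m → HasSum (fun n ↦ c n * (t ^ m) ^ n) 0) (N : ℕ) : c N = 0 := by
  induction N using Nat.strong_induction_on with
  | _ N ih =>
  have hle : ∀ m, 1 ≤ m → ‖c N‖ ≤ ‖t‖ ^ m := by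
    intro m hm
    have hpos : 0 < ‖t‖ ^ m := by positivity
    have hpow1 : ‖t‖ ^ m ≤ 1 := pow_le_one₀ ht0.le ht1.le
    have hs := (hasSum_ite_sub_hasSum (h m hm) N).norm_le_of_forall_norm_le
      (C := (‖t‖ ^ m) ^ (N + 1)) (by positivity) (fun n ↦ by
        split_ifs with hn
        · simp
        rcases lt_or_gt_of_ne hn with hn | hn
        · simp [ih n hn]
        · rw [norm_mul, norm_pow, norm_pow]
          calc ‖c n‖ * (‖t‖ ^ m) ^ n ≤ 1 * (‖t‖ ^ m) ^ n := by gcongr; exact hc n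
            _ ≤ (‖t‖ ^ m) ^ (N + 1) := by
              rw [one_mul]; exact pow_le_pow_of_le_one hpos.le hpow1 hn)
    rw [zero_sub, norm_neg, norm_mul, norm_pow, norm_pow, pow_succ'] at hs
    exact le_of_mul_le_mul_right hs (by positivity)
  have hlim := tendsto_pow_atTop_nhds_zero_of_lt_one ht0.le ht1
  exact norm_le_zero_iff.mp
    (ge_of_tendsto hlim ((eventually_ge_atTop 1).mono hle))

/-- If a power series `∑ a_I z^I` (with `|a_I| ≤ 1`) over a complete
non-Archimedean field `K` vanishes at every point `z` with coordinates in a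
subfield `k` (on which the absolute value is nontrivial) of norm `< 1`, then
all coefficients `a_I` vanish. -/
theorem stmt9 {K : Type*} [NormedField K] [IsUltrametricDist K] [CompleteSpace K]
    (k : Subfield K) (t : K) (htk : t ∈ k) (ht0 : 0 < ‖t‖) (ht1 : ‖t‖ < 1)
    (r : ℕ) (hr : 1 ≤ r)
    (a : (Fin r → ℕ) → K) (ha : ∀ I, ‖a I‖ ≤ 1)
    (hsum : ∀ z : Fin r → K, (∀ i, z i ∈ k) → (∀ i, ‖z i‖ < 1) →
      HasSum (fun I : Fin r → ℕ => a I * ∏ i, z i ^ (I i)) 0) :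
    ∀ I, a I = 0 := by
  clear hr
  induction r with
  | zero =>
    intro I
    have h := hsum 0 (fun i ↦ i.elim0) (fun i ↦ i.elim0)
    have h' := (hasSum_unique (fun I : Fin 0 → ℕ ↦ a I * ∏ i, (0 : Fin 0 → K) i ^ I i)).unique h
    rw [Unique.eq_default I]
    simpa using h'
  | succ r ih =>
    have key : ∀ z : Fin r → K, (∀ i, z i ∈ k) → (∀ i, ‖z i‖ < 1) → ∀ n,
        HasSum (fun J : Fin r → ℕ ↦ a (Fin.cons n J) * ∏ i, z i ^ J i) 0 := by
      intro z hzk hz1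
      have hprod : ∀ x ∈ k, ‖x‖ < 1 → HasSum (fun p : ℕ × (Fin r → ℕ) ↦
          a (Fin.cons p.1 p.2) * (∏ i, z i ^ p.2 i) * x ^ p.1) 0 := by
        intro x hxk hx1
        have h := hsum (Fin.cons x z) (Fin.cases hxk hzk) (Fin.cases hx1 hz1)
        rw [← (Fin.consEquiv fun _ : Fin (r + 1) ↦ ℕ).hasSum_iff] at h
        convert h using 2 with p
        simp [Fin.prod_univ_succ, Fin.consEquiv]
        ring
      have hsummable : ∀ n,
          Summable fun J : Fin r → ℕ ↦ a (Fin.cons n J) * ∏ i, z i ^ J i := fun n ↦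
        (summable_mul_right_iff (pow_ne_zero n (norm_pos_iff.mp ht0))).mp
          ((hprod t htk ht1).summable.prod_factor n)
      have hzero := eq_zero_of_hasSum_pow_eq_zero ht0 ht1
        (c := fun n ↦ ∑' J : Fin r → ℕ, a (Fin.cons n J) * ∏ i, z i ^ J i)
        (fun n ↦ (hsummable n).hasSum.norm_le_of_forall_norm_le zero_le_one fun J ↦ by
          rw [norm_mul, norm_prod]
          refine mul_le_one₀ (ha _) (by positivity) (Finset.prod_le_one (by simp) fun i _ ↦ ?_)
          rw [norm_pow]
          exact pow_le_one₀ (norm_nonneg _) (hz1 i).le)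
        (fun m hm ↦ (hprod (t ^ m) (pow_mem htk m) (by
          rw [norm_pow]; exact pow_lt_one₀ ht0.le ht1 (by omega))).prod_fiberwise
          fun n ↦ (hsummable n).hasSum.mul_right _)
      intro n
      simpa only [hzero n] using (hsummable n).hasSum
    intro I
    rw [← Fin.cons_self_tail I]
    exact ih (fun J ↦ a (Fin.cons (I 0) J)) (fun _ ↦ ha _)
      (fun z hzk hz1 ↦ key z hzk hz1 (I 0)) (Fin.tail I)
end

section
/- Let a : ℕ → K be a sequence with |a_i| → 0 as i → ∞, and for z ∈ K with |z| ≤ 1 set f(z) = ∑_{i ≥ 0} a_i z^i (a convergent series in K). Suppose there is an injective sequence (x_n) of elements of k with |x_n| ≤ 1 for all n, converging to some limit in K, such that f(x_n) ∈ k for every n. Then a_i ∈ k for every i ≥ 0. -/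
open Filter

/-- A vector-valued power series whose coefficients tend to zero converges on the closed unit
ball. -/
theorem summable_pow_smul_of_tendsto_zero {F V : Type*} [NormedField F] [NormedAddCommGroup V]
    [IsUltrametricDist V] [CompleteSpace V] [NormedSpace F V] {a : ℕ → V}
    (ha : Tendsto a atTop (nhds 0)) {z : F} (hz : ‖z‖ ≤ 1) :
    Summable fun i => z ^ i • a i := by
  apply NonarchimedeanAddGroup.summable_of_tendsto_cofinite_zero
  rw [Nat.cofinite_eq_atTop]
  refine squeeze_zero_norm (fun i => ?_) (tendsto_zero_iff_norm_tendsto_zero.mp ha)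
  rw [norm_smul, norm_pow]
  exact mul_le_of_le_one_left (norm_nonneg _) (pow_le_one₀ (norm_nonneg _) hz)

/-- A uniform bound on the coefficients bounds the values of the power series on the closed unit
ball. -/
theorem norm_tsum_pow_smul_le {F V : Type*} [NormedField F] [NormedAddCommGroup V]
    [IsUltrametricDist V] [NormedSpace F V] {a : ℕ → V} {δ : ℝ}
    (ha : ∀ i, ‖a i‖ ≤ δ) {z : F} (hz : ‖z‖ ≤ 1) :
    ‖∑' i, z ^ i • a i‖ ≤ δ := by
  refine IsUltrametricDist.norm_tsum_le_of_forall_le fun i => le_trans ?_ (ha i)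
  rw [norm_smul, norm_pow]
  exact mul_le_of_le_one_left (norm_nonneg _) (pow_le_one₀ (norm_nonneg _) hz)

theorem tsum_pow_smul_eq_add {F V : Type*} [NormedField F] [NormedAddCommGroup V]
    [IsUltrametricDist V] [CompleteSpace V] [NormedSpace F V] {a : ℕ → V}
    (ha : Tendsto a atTop (nhds 0)) {z : F} (hz : ‖z‖ ≤ 1) :
    ∑' i, z ^ i • a i = a 0 + z • ∑' i, z ^ i • a (i + 1) := by
  rw [(summable_pow_smul_of_tendsto_zero ha hz).tsum_eq_zero_add]
  have h := summable_pow_smul_of_tendsto_zero ((tendsto_add_atTop_iff_nat 1).mpr ha) hz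
  rw [← h.tsum_const_smul]
  simp [pow_succ', mul_smul]

/-- **Strassmann's theorem** for vector-valued power series: if the coefficients after the `N`-th
one are uniformly smaller than the `N`-th one, then there are at most `N` zeros in the closed
unit ball. -/
theorem card_le_of_tsum_pow_smul_eq_zero {F V : Type*} [NormedField F] [NormedAddCommGroup V]
    [IsUltrametricDist V] [CompleteSpace V] [NormedSpace F V] (N : ℕ) {a : ℕ → V} {δ : ℝ}
    (ha : Tendsto a atTop (nhds 0)) (hδ : δ < ‖a N‖) (hN : ∀ i, N < i → ‖a i‖ ≤ δ)
    (s : Finset F) (hs : ∀ z ∈ s, ‖z‖ ≤ 1 ∧ ∑' i, z ^ i • a i = 0) :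
    s.card ≤ N := by
  classical
  induction N generalizing a s with
  | zero =>
    rw [Nat.le_zero, Finset.card_eq_zero, Finset.eq_empty_iff_forall_notMem]
    intro z hz
    obtain ⟨hz1, hz0⟩ := hs z hz
    rw [tsum_pow_smul_eq_add ha hz1] at hz0
    have h := norm_tsum_pow_smul_le (fun i => hN (i + 1) i.succ_pos) hz1
    rw [eq_neg_of_add_eq_zero_left hz0, norm_neg, norm_smul] at hδ
    exact absurd (mul_le_of_le_one_left (norm_nonneg _) hz1) (by linarith)
  | succ N ih =>
    rcases s.eq_empty_or_nonempty with rfl | ⟨α, hα⟩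
    · simp
    obtain ⟨hα1, hα0⟩ := hs α hα
    set c : ℕ → V := fun m => ∑' i, α ^ i • a (i + (m + 1)) with hc
    have hrec (m : ℕ) : c m = a (m + 1) + α • c (m + 1) := by
      simp only [hc]
      rw [tsum_pow_smul_eq_add ((tendsto_add_atTop_iff_nat (m + 1)).mpr ha) hα1]
      simp only [zero_add, add_assoc, add_comm 1]
    have hzero : a 0 + α • c 0 = 0 := by
      rw [← hα0, tsum_pow_smul_eq_add ha hα1]
    have hcb {m : ℕ} {ε : ℝ} (h : ∀ i, m < i → ‖a i‖ ≤ ε) : ‖c m‖ ≤ ε :=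
      norm_tsum_pow_smul_le (fun i => h _ (by omega)) hα1
    have hct : Tendsto c atTop (nhds 0) := by
      rw [Metric.tendsto_atTop] at ha ⊢
      intro ε hε
      obtain ⟨M, hM⟩ := ha (ε / 2) (half_pos hε)
      refine ⟨M, fun n hn => ?_⟩
      rw [dist_zero_right]
      refine (hcb fun i hi => ?_).trans_lt (half_lt_self hε)
      have := hM i (by omega)
      rw [dist_zero_right] at this
      exact this.le
    have hcN : ‖c N‖ = ‖a (N + 1)‖ := by
      have h : ‖α • c (N + 1)‖ < ‖a (N + 1)‖ := by
        rw [norm_smul]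
        exact (mul_le_of_le_one_left (norm_nonneg _) hα1).trans_lt ((hcb hN).trans_lt hδ)
      rw [hrec, IsUltrametricDist.norm_add_eq_max_of_norm_ne_norm h.ne', max_eq_left h.le]
    have hcard := ih hct (hcN ▸ hδ)
      (fun i hi => hcb fun j hj => hN j (by omega)) (s.erase α) (by
        intro z hz
        obtain ⟨hne, hzs⟩ := Finset.mem_erase.mp hz
        obtain ⟨hz1, hz0⟩ := hs z hzs
        refine ⟨hz1, ?_⟩
        have hct' := (tendsto_add_atTop_iff_nat 1).mpr hct
        have hsum : ∑' i, z ^ i • a (i + 1)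
            = ∑' i, z ^ i • c i - α • ∑' i, z ^ i • c (i + 1) := by
          have h1 := summable_pow_smul_of_tendsto_zero hct hz1
          have h2 := summable_pow_smul_of_tendsto_zero hct' hz1
          rw [← h2.tsum_const_smul, ← h1.tsum_sub (h2.const_smul α)]
          refine tsum_congr fun i => ?_
          rw [eq_sub_of_add_eq (hrec i).symm, smul_sub, smul_comm]
        rw [tsum_pow_smul_eq_add ha hz1, hsum, eq_neg_of_add_eq_zero_left hzero] at hz0
        have hz2 := tsum_pow_smul_eq_add hct hz1
        have hfac : (z - α) • ∑' i, z ^ i • c i = 0 := by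
          rw [← hz0, sub_smul, smul_sub, smul_comm z α]
          nth_rewrite 2 [hz2]
          rw [smul_add]
          abel
        exact (smul_eq_zero.mp hfac).resolve_left (sub_ne_zero.mpr hne))
    rw [Finset.card_erase_of_mem hα] at hcard
    omega

/-- A nonzero null sequence has a last term dominating uniformly all later ones. -/
theorem exists_forall_lt_norm_le_of_tendsto_zero {V : Type*} [NormedAddCommGroup V] {a : ℕ → V}
    (ha : Tendsto a atTop (nhds 0)) {j : ℕ} (hj : a j ≠ 0) :
    ∃ (N : ℕ) (δ : ℝ), δ < ‖a N‖ ∧ ∀ i, N < i → ‖a i‖ ≤ δ := by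
  classical
  have hr : 0 < ‖a j‖ := norm_pos_iff.mpr hj
  have hex : ∃ n, ∃ δ < ‖a j‖, ∀ i, n ≤ i → ‖a i‖ ≤ δ := by
    obtain ⟨M, hM⟩ := Metric.tendsto_atTop.mp ha (‖a j‖ / 2) (half_pos hr)
    exact ⟨M, ‖a j‖ / 2, half_lt_self hr, fun i hi => by simpa using (hM i hi).le⟩
  obtain ⟨δ, hδ, hle⟩ := Nat.find_spec hex
  rcases hn : Nat.find hex with _ | N
  · exact absurd (hle j (by omega)) hδ.not_ge
  refine ⟨N, δ, ?_, fun i hi => hle i (by omega)⟩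
  by_contra! hlt
  refine Nat.find_min hex (m := N) (by omega) ⟨δ, hδ, fun i hi => ?_⟩
  rcases hi.eq_or_lt with rfl | hi
  · exact hlt
  · exact hle i (by omega)

/-- The quotient of an ultrametric normed group by a submodule is ultrametric. -/
theorem Submodule.Quotient.isUltrametricDist {R M : Type*} [Ring R] [SeminormedAddCommGroup M]
    [IsUltrametricDist M] [Module R M] (p : Submodule R M) : IsUltrametricDist (M ⧸ p) := by
  refine IsUltrametricDist.isUltrametricDist_of_forall_norm_add_le_max_norm fun x y => ?_
  refine le_of_forall_gt fun r hr => ?_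
  obtain ⟨u, rfl, hu⟩ := QuotientAddGroup.norm_lt_iff.mp ((le_max_left _ _).trans_lt hr)
  obtain ⟨v, rfl, hv⟩ := QuotientAddGroup.norm_lt_iff.mp ((le_max_right _ _).trans_lt hr)
  exact QuotientAddGroup.norm_lt_iff.mpr
    ⟨u + v, rfl, (IsUltrametricDist.norm_add_le_max u v).trans_lt (max_lt hu hv)⟩

/-- If a convergent power series `f z = ∑ a_i z^i` over a complete
non-Archimedean field `K` takes values in a closed subfield `k` (on which the
absolute value is nontrivial) at the points of an injective convergent sequence
of elements of `k` in the closed unit ball, then all coefficients lie in `k`. -/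
theorem stmt10 {K : Type*} [NormedField K] [IsUltrametricDist K] [CompleteSpace K]
    (k : Subfield K) (hk : IsClosed (k : Set K))
    (t : K) (htk : t ∈ k) (ht0 : 0 < ‖t‖) (ht1 : ‖t‖ < 1)
    (a : ℕ → K) (ha : Tendsto (fun i => ‖a i‖) atTop (nhds 0))
    (f : K → K)
    (hf : ∀ z : K, ‖z‖ ≤ 1 → HasSum (fun i => a i * z ^ i) (f z))
    (x : ℕ → K) (hinj : Function.Injective x)
    (hxk : ∀ n, x n ∈ k) (hxle : ∀ n, ‖x n‖ ≤ 1)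
    (hconv : ∃ L : K, Tendsto x atTop (nhds L))
    (hfx : ∀ n, f (x n) ∈ k) :
    ∀ i, a i ∈ k := by
  let _ : NormedSpace k K := { norm_smul_le := fun c v => (norm_mul (c : K) v).le }
  let p : Submodule k K :=
    { k.toAddSubgroup with smul_mem' := fun c _ hv => k.mul_mem c.2 hv }
  have : IsClosed (p : Set K) := hk
  have := Submodule.Quotient.isUltrametricDist p
  have hmem {v : K} : p.mkQ v = 0 ↔ v ∈ k := Submodule.Quotient.mk_eq_zero p
  have hcont : Continuous p.mkQ := continuous_quot_mk
  have ha' : Tendsto (fun i => p.mkQ (a i)) atTop (nhds 0) :=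
    squeeze_zero_norm (fun i => Submodule.Quotient.norm_mk_le p (a i)) ha
  by_contra! ⟨j, hj⟩
  obtain ⟨N, δ, hδ, hN⟩ := exists_forall_lt_norm_le_of_tendsto_zero ha' (mt hmem.mp hj)
  have hinj' : Function.Injective fun n => (⟨x n, hxk n⟩ : k) :=
    fun m n h => hinj (congrArg Subtype.val h)
  have hcard := card_le_of_tsum_pow_smul_eq_zero N ha' hδ hN
    ((Finset.range (N + 1)).map ⟨_, hinj'⟩) (by
      intro z hz
      obtain ⟨n, -, rfl⟩ := Finset.mem_map.mp hz
      refine ⟨hxle n, ?_⟩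
      have h := (hf (x n) (hxle n)).map p.mkQ hcont
      rw [hmem.mpr (hfx n)] at h
      refine Eq.trans (tsum_congr fun i => ?_) h.tsum_eq
      rw [Function.comp_apply, mul_comm]
      rfl)
  simp at hcard
end

section
/- Let a : ℕ → K be a sequence with |a_i| → 0 as i → ∞, and for z ∈ K with |z| ≤ 1 set f(z) = ∑_{i ≥ 0} a_i z^i (a convergent series in K). Suppose there is an injective sequence (x_n) of elements of K with |x_n| ≤ 1 for all n, converging to some limit in K, and an element y ∈ K such that f(x_n) = y for every n. Then a_i = 0 for every i ≥ 1 and a_0 = y; that is, f is constant equal to y on the closed unit ball of K. -/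
open Filter

theorem exists_last_max_norm {E : Type*} [NormedAddCommGroup E] {a : ℕ → E}
    (ha : Tendsto a atTop (nhds 0)) {k : ℕ} (hk : a k ≠ 0) :
    ∃ N, (∀ i, ‖a i‖ ≤ ‖a N‖) ∧ ∀ i, N < i → ‖a i‖ < ‖a N‖ := by
  have hfin : {i | ‖a k‖ ≤ ‖a i‖}.Finite := by
    have := (tendsto_zero_iff_norm_tendsto_zero.mp ha).eventually_lt_const (norm_pos_iff.mpr hk)
    rw [← Nat.cofinite_eq_atTop, eventually_cofinite] at this
    simpa only [not_lt] using this
  obtain ⟨N, hN, hmax⟩ := Set.exists_max_image _ (fun i => toLex (‖a i‖, i)) hfin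
    ⟨k, le_refl ‖a k‖⟩
  have hlex : ∀ i, ‖a i‖ < ‖a N‖ ∨ ‖a i‖ = ‖a N‖ ∧ i ≤ N := by
    intro i
    rcases le_or_gt ‖a k‖ ‖a i‖ with hi | hi
    · simpa [Prod.Lex.toLex_le_toLex] using hmax i hi
    · exact Or.inl (hi.trans_le hN)
  refine ⟨N, fun i => (hlex i).elim le_of_lt fun h => h.1.le, fun i hi => ?_⟩
  exact (hlex i).resolve_right fun h => by omega

section Strassmann

variable {K : Type*} [NormedField K] [IsUltrametricDist K]

/-- The `j`-th coefficient of `f / (z - x)`, when `f z = ∑ a_i z^i` vanishes at `x`. -/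
noncomputable def quotientCoeff (a : ℕ → K) (x : K) (j : ℕ) : K :=
  ∑' i, a (i + (j + 1)) * x ^ i

theorem summable_mul_pow_of_tendsto_zero [CompleteSpace K] {a : ℕ → K}
    (ha : Tendsto a atTop (nhds 0)) {x : K} (hx : ‖x‖ ≤ 1) :
    Summable fun i => a i * x ^ i := by
  apply NonarchimedeanAddGroup.summable_of_tendsto_cofinite_zero
  rw [Nat.cofinite_eq_atTop]
  refine squeeze_zero_norm (fun i => ?_) (tendsto_zero_iff_norm_tendsto_zero.mp ha)
  rw [norm_mul, norm_pow]
  exact mul_le_of_le_one_right (norm_nonneg _) (pow_le_one₀ (norm_nonneg _) hx)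

theorem tsum_mul_pow_eq_add_mul_tsum [CompleteSpace K] {a : ℕ → K}
    (ha : Tendsto a atTop (nhds 0)) {x : K} (hx : ‖x‖ ≤ 1) :
    ∑' i, a i * x ^ i = a 0 + x * quotientCoeff a x 0 := by
  rw [(summable_mul_pow_of_tendsto_zero ha hx).tsum_eq_zero_add, quotientCoeff, ← tsum_mul_left]
  simp only [pow_zero, mul_one, zero_add]
  congr 1
  exact tsum_congr fun i => by ring

theorem quotientCoeff_eq [CompleteSpace K] {a : ℕ → K}
    (ha : Tendsto a atTop (nhds 0)) {x : K} (hx : ‖x‖ ≤ 1) (j : ℕ) :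
    quotientCoeff a x j = a (j + 1) + x * quotientCoeff a x (j + 1) := by
  have h := tsum_mul_pow_eq_add_mul_tsum ((tendsto_add_atTop_iff_nat (j + 1)).mpr ha) hx
  simpa only [quotientCoeff, zero_add, add_assoc, add_comm, add_left_comm] using h

theorem tendsto_quotientCoeff {a : ℕ → K}
    (ha : Tendsto a atTop (nhds 0)) {x : K} (hx : ‖x‖ ≤ 1) :
    Tendsto (quotientCoeff a x) atTop (nhds 0) := by
  rw [Metric.tendsto_atTop] at ha ⊢
  intro ε hε
  obtain ⟨n, hn⟩ := ha (ε / 2) (half_pos hε)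
  refine ⟨n, fun j hj => ?_⟩
  rw [dist_zero_right]
  refine lt_of_le_of_lt ?_ (half_lt_self hε)
  refine IsUltrametricDist.norm_tsum_le_of_forall_le_of_nonneg (half_pos hε).le fun i => ?_
  rw [norm_mul, norm_pow]
  refine (mul_le_of_le_one_right (norm_nonneg _) (pow_le_one₀ (norm_nonneg _) hx)).trans ?_
  simpa using (hn (i + (j + 1)) (by omega)).le

theorem norm_quotientCoeff_lt [CompleteSpace K] {a : ℕ → K}
    (ha : Tendsto a atTop (nhds 0)) {x : K} (hx : ‖x‖ ≤ 1) {C : ℝ} (hC : 0 < C) {N : ℕ}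
    (h : ∀ i, N < i → ‖a i‖ < C) {j : ℕ} (hj : N ≤ j) : ‖quotientCoeff a x j‖ < C := by
  obtain ⟨n, hn⟩ := Metric.tendsto_atTop.mp (tendsto_quotientCoeff ha hx) C hC
  have key : ∀ k j, N ≤ j → n ≤ j + k → ‖quotientCoeff a x j‖ < C := by
    intro k
    induction k with
    | zero => exact fun j _ hj => by simpa using hn j hj
    | succ k ih =>
      intro j hNj hj
      rw [quotientCoeff_eq ha hx]
      refine (IsUltrametricDist.norm_add_le_max _ _).trans_lt (max_lt (h _ (by omega)) ?_)
      rw [norm_mul]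
      exact (mul_le_of_le_one_left (norm_nonneg _) hx).trans_lt (ih _ (by omega) (by omega))
  exact key n j hj (by omega)

theorem hasSum_quotientCoeff [CompleteSpace K] {a : ℕ → K}
    (ha : Tendsto a atTop (nhds 0)) {x z : K} (hx : ‖x‖ ≤ 1) (hz : ‖z‖ ≤ 1)
    (hxs : HasSum (fun i => a i * x ^ i) 0) (hzs : HasSum (fun i => a i * z ^ i) 0)
    (hne : z ≠ x) : HasSum (fun i => quotientCoeff a x i * z ^ i) 0 := by
  set b := quotientCoeff a x
  have hb : Tendsto b atTop (nhds 0) := tendsto_quotientCoeff ha hx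
  have hs := summable_mul_pow_of_tendsto_zero hb hz
  have h0 : a 0 + x * b 0 = 0 := by
    rw [← tsum_mul_pow_eq_add_mul_tsum ha hx, hxs.tsum_eq]
  have hpartial : ∀ n, ∑ i ∈ Finset.range (n + 1), a i * z ^ i =
      (z - x) * ∑ i ∈ Finset.range n, b i * z ^ i - x * (b n * z ^ n) := by
    intro n
    induction n with
    | zero => simp; linear_combination h0
    | succ n ih =>
      rw [Finset.sum_range_succ, ih, Finset.sum_range_succ _ n]
      have := quotientCoeff_eq ha hx n
      linear_combination (-z ^ (n + 1)) * this
  have hlim := (hs.hasSum.tendsto_sum_nat.const_mul (z - x)).sub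
    (hs.tendsto_atTop_zero.const_mul x)
  have heq := tendsto_nhds_unique
    (((tendsto_add_atTop_iff_nat 1).mpr hzs.tendsto_sum_nat).congr hpartial) hlim
  have hzero : ∑' i, b i * z ^ i = 0 := by
    simpa [sub_ne_zero.mpr hne] using heq.symm
  exact hzero ▸ hs.hasSum

/-- Strassmann's theorem, where `N` is the last index at which `‖a i‖` is maximal. -/
theorem finite_zeros_of_dominant_coeff [CompleteSpace K] (N : ℕ) {a : ℕ → K}
    (ha : Tendsto a atTop (nhds 0)) (hle : ∀ i, ‖a i‖ ≤ ‖a N‖)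
    (hlt : ∀ i, N < i → ‖a i‖ < ‖a N‖) :
    {z : K | ‖z‖ ≤ 1 ∧ HasSum (fun i => a i * z ^ i) 0}.Finite := by
  induction N generalizing a with
  | zero =>
    convert Set.finite_empty
    refine Set.eq_empty_of_forall_notMem fun z ⟨hz, hzs⟩ => ?_
    have hpos : 0 < ‖a 0‖ := (norm_nonneg _).trans_lt (hlt 1 one_pos)
    have hb := norm_quotientCoeff_lt ha hz hpos hlt le_rfl
    have h0 := tsum_mul_pow_eq_add_mul_tsum ha hz
    rw [hzs.tsum_eq] at h0
    rw [eq_neg_of_add_eq_zero_left h0.symm, norm_neg, norm_mul] at hb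
    exact (hb.trans_le (mul_le_of_le_one_left (norm_nonneg _) hz)).false
  | succ N ih =>
    by_cases hex : ∃ x : K, ‖x‖ ≤ 1 ∧ HasSum (fun i => a i * x ^ i) 0
    · obtain ⟨x, hx, hxs⟩ := hex
      have hpos : 0 < ‖a (N + 1)‖ := (norm_nonneg _).trans_lt (hlt (N + 2) (by omega))
      have htail : ∀ j, N < j → ‖quotientCoeff a x j‖ < ‖a (N + 1)‖ := fun j hj =>
        norm_quotientCoeff_lt ha hx hpos hlt hj
      have hxb : ‖x * quotientCoeff a x (N + 1)‖ < ‖a (N + 1)‖ := by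
        rw [norm_mul]
        exact (mul_le_of_le_one_left (norm_nonneg _) hx).trans_lt (htail _ (by omega))
      have hN : ‖quotientCoeff a x N‖ = ‖a (N + 1)‖ := by
        rw [quotientCoeff_eq ha hx, IsUltrametricDist.norm_add_eq_max_of_norm_ne_norm hxb.ne',
          max_eq_left hxb.le]
      have hbound : ∀ j, ‖quotientCoeff a x j‖ ≤ ‖quotientCoeff a x N‖ := by
        intro j
        refine IsUltrametricDist.norm_tsum_le_of_forall_le_of_nonneg (norm_nonneg _) fun i => ?_
        rw [norm_mul, norm_pow, hN]
        exact (mul_le_of_le_one_right (norm_nonneg _)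
          (pow_le_one₀ (norm_nonneg _) hx)).trans (hle _)
      refine ((ih (tendsto_quotientCoeff ha hx) hbound (hN ▸ htail)).insert x).subset ?_
      rintro z ⟨hz, hzs⟩
      by_cases hne : z = x
      · exact Or.inl hne
      · exact Or.inr ⟨hz, hasSum_quotientCoeff ha hx hz hxs hzs hne⟩
    · convert Set.finite_empty
      exact Set.eq_empty_of_forall_notMem fun z hz => hex ⟨z, hz⟩

/-- A power series with coefficients tending to zero which vanishes at infinitely many points of
the closed unit ball is zero. -/
theorem eq_zero_of_infinite_zeros [CompleteSpace K] {a : ℕ → K}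
    (ha : Tendsto a atTop (nhds 0))
    (hinf : {z : K | ‖z‖ ≤ 1 ∧ HasSum (fun i => a i * z ^ i) 0}.Infinite) (i : ℕ) : a i = 0 := by
  by_contra hi
  obtain ⟨N, hle, hlt⟩ := exists_last_max_norm ha hi
  exact hinf (finite_zeros_of_dominant_coeff N ha hle hlt)

end Strassmann

/-- Principle of isolated zeros: if a convergent power series
`f z = ∑ a_i z^i` on the closed unit ball of a complete nontrivially valued
non-Archimedean field takes the same value `y` along an injective convergent
sequence of points of the ball, then `a_i = 0` for `i ≥ 1`, `a_0 = y`, and `f`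
is constant equal to `y` on the closed unit ball. -/
theorem stmt11 {K : Type*} [NormedField K] [IsUltrametricDist K] [CompleteSpace K]
    (ht : ∃ t : K, 0 < ‖t‖ ∧ ‖t‖ < 1)
    (a : ℕ → K) (ha : Tendsto (fun i => ‖a i‖) atTop (nhds 0))
    (f : K → K)
    (hf : ∀ z : K, ‖z‖ ≤ 1 → HasSum (fun i => a i * z ^ i) (f z))
    (x : ℕ → K) (hinj : Function.Injective x) (hxle : ∀ n, ‖x n‖ ≤ 1)
    (hconv : ∃ L : K, Tendsto x atTop (nhds L))
    (y : K) (hfx : ∀ n, f (x n) = y) :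
    (∀ i, 1 ≤ i → a i = 0) ∧ a 0 = y ∧ ∀ z : K, ‖z‖ ≤ 1 → f z = y := by
  have hc : Tendsto (fun i => a i - if i = 0 then y else 0) atTop (nhds 0) := by
    refine (tendsto_zero_iff_norm_tendsto_zero.mpr ha).congr' ?_
    filter_upwards [eventually_ne_atTop 0] with i hi
    simp [hi]
  have hinf : {z : K | ‖z‖ ≤ 1 ∧
      HasSum (fun i => (a i - if i = 0 then y else 0) * z ^ i) 0}.Infinite := by
    refine (Set.infinite_range_of_injective hinj).mono ?_
    rintro _ ⟨n, rfl⟩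
    refine ⟨hxle n, ?_⟩
    have h := (hf (x n) (hxle n)).sub (hasSum_ite_eq 0 y)
    rw [hfx, sub_self] at h
    refine h.congr_fun fun i => ?_
    by_cases hi : i = 0 <;> simp [hi]
  have hzero := eq_zero_of_infinite_zeros hc hinf
  have hpos : ∀ i, 1 ≤ i → a i = 0 := fun i hi => by
    simpa [Nat.one_le_iff_ne_zero.mp hi] using hzero i
  have h0 : a 0 = y := by simpa [sub_eq_zero] using hzero 0
  refine ⟨hpos, h0, fun z hz => (hf z hz).unique ?_⟩
  have h := hasSum_single (f := fun i => a i * z ^ i) 0 fun i hi => by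
    simp [hpos i (Nat.one_le_iff_ne_zero.mpr hi)]
  simpa [h0] using h
end
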